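/- arXiv:1603.04517 — 2 statements merged into one kernel-verified Lean document; each statement's English description precedes it below -/
import Mathlib

section
/- For every integer l ≥ 2, the skew-growth polynomial N_{B_l}(t) = Σ_{J ⊆ {1,...,l}} (-1)^{#J} t^{deg_B(J)} ∈ ℤ[t] has t = 1 as a root of multiplicity exactly one (a simple root). -/
open scoped Classical

/-- Adjacency for the type `A_l` Coxeter graph (the path `1—2—⋯—l`). -/
def adjA (a b : ℕ) : Prop := b = a + 1

/-- Adjacency for the type `D_l` Coxeter graph on `{1,…,l}`: edges `{i, i+1}` for
`1 ≤ i ≤ l-2` together with the edge `{l-2, l}` (so `l-1` and `l` are not adjacent). -/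
def adjD (l : ℕ) (a b : ℕ) : Prop :=
  (b = a + 1 ∧ a ≠ l - 1) ∨ (a = l - 2 ∧ b = l)

/-- The vertex sets of the connected components of the graph induced on the finite
set `J` by the (symmetrized) adjacency relation `r`. -/
noncomputable def componentsOf (r : ℕ → ℕ → Prop) (J : Finset ℕ) : Finset (Finset ℕ) :=
  J.image fun x =>
    J.filter fun y =>
      Relation.ReflTransGen (fun a b => a ∈ J ∧ b ∈ J ∧ (r a b ∨ r b a)) x y

/-- The number of maximal blocks of consecutive integers in `J`
(the connected components of the induced subgraph of the path graph). -/
noncomputable def kA (J : Finset ℕ) : ℕ := (componentsOf adjA J).card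

/-- The degree of the fundamental element of the Artin monoid of type `A_l`
associated to `J`: the sum over the maximal consecutive blocks `B` of `J`
of `binom(#B + 1, 2)`. -/
noncomputable def degA (J : Finset ℕ) : ℕ :=
  ∑ B ∈ componentsOf adjA J, (B.card + 1).choose 2

/-- The degree of the fundamental element of the Artin monoid of type `B_l`
associated to `J`: the sum over the maximal consecutive blocks `B` of `J` of
`(#B)^2` if `{1,2} ⊆ B` and `binom(#B + 1, 2)` otherwise. -/
noncomputable def degB (J : Finset ℕ) : ℕ :=
  ∑ B ∈ componentsOf adjA J,
    if 1 ∈ B ∧ 2 ∈ B then B.card ^ 2 else (B.card + 1).choose 2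

/-- The degree of the fundamental element of the Artin monoid of type `D_l`
associated to `J`: the sum over the connected components `C` of the induced
subgraph of the type `D_l` Coxeter graph on `J` of `#C·(#C - 1)` if
`{l-1, l} ⊆ C` and `binom(#C + 1, 2)` otherwise. -/
noncomputable def degD (l : ℕ) (J : Finset ℕ) : ℕ :=
  ∑ C ∈ componentsOf (adjD l) J,
    if l - 1 ∈ C ∧ l ∈ C then C.card * (C.card - 1) else (C.card + 1).choose 2

/-- The skew-growth polynomial of type `B_l`. -/
noncomputable def NB (l : ℕ) : Polynomial ℤ :=
  ∑ J ∈ (Finset.Icc 1 l).powerset, (-1 : Polynomial ℤ) ^ J.card * Polynomial.X ^ degB J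


/-- The number of positive roots of type `B` whose support is the interval `[a,b]`. -/
def wB (p : ℕ × ℕ) : ℕ := if p.1 = 1 then p.2 else 1

/-- The connectivity relation inside `J`. -/
abbrev stepJ (J : Finset ℕ) (a b : ℕ) : Prop := a ∈ J ∧ b ∈ J ∧ (adjA a b ∨ adjA b a)

/-- The component of `x` in `J`. -/
noncomputable def compJ (J : Finset ℕ) (x : ℕ) : Finset ℕ :=
  J.filter fun y => Relation.ReflTransGen (stepJ J) x y

lemma stepJ_symm (J : Finset ℕ) {x y : ℕ} (h : Relation.ReflTransGen (stepJ J) x y) :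
    Relation.ReflTransGen (stepJ J) y x := by
  induction h with
  | refl => exact .refl
  | tail _ h ih => exact .head ⟨h.2.1, h.1, h.2.2.symm⟩ ih

lemma reach_between (J : Finset ℕ) {x y : ℕ} (hx : x ∈ J)
    (h : Relation.ReflTransGen (stepJ J) x y) :
    ∀ z, (x ≤ z ∧ z ≤ y) ∨ (y ≤ z ∧ z ≤ x) → z ∈ J := by
  induction h with
  | refl => intro z hz; have : z = x := by omega
            exact this ▸ hx
  | @tail b c _ h ih =>
    intro z hz
    by_cases hzc : z = c
    · exact hzc ▸ h.2.1
    · apply ih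
      have := h.2.2
      unfold adjA at this
      omega

lemma reach_of_Icc (J : Finset ℕ) (x k : ℕ) (h : Finset.Icc x (x + k) ⊆ J) :
    Relation.ReflTransGen (stepJ J) x (x + k) := by
  induction k with
  | zero => exact .refl
  | succ k ih =>
    refine .tail (ih (fun z hz => h ?_)) ⟨h ?_, h ?_, Or.inl ?_⟩
    · simp at hz ⊢; omega
    · simp
    · simp
    · unfold adjA; omega

lemma reach_of_Icc' (J : Finset ℕ) {x y : ℕ} (hxy : x ≤ y) (h : Finset.Icc x y ⊆ J) :
    Relation.ReflTransGen (stepJ J) x y := by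
  obtain ⟨k, rfl⟩ := Nat.exists_eq_add_of_le hxy
  exact reach_of_Icc J x k h

lemma compJ_eq (J : Finset ℕ) {x y : ℕ} (h : Relation.ReflTransGen (stepJ J) x y) :
    compJ J x = compJ J y := by
  ext z
  simp only [compJ, Finset.mem_filter]
  exact and_congr_right fun _ => ⟨fun g => (stepJ_symm J h).trans g, fun g => h.trans g⟩

lemma compJ_interval (J : Finset ℕ) {x : ℕ} (hx : x ∈ J) :
    ∃ m M, m ≤ M ∧ compJ J x = Finset.Icc m M := by
  have hne : (compJ J x).Nonempty := ⟨x, by simp [compJ, hx, Relation.ReflTransGen.refl]⟩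
  refine ⟨_, _, Finset.min'_le_max' _ hne, ?_⟩
  ext z
  rw [Finset.mem_Icc]
  refine ⟨fun h => ⟨Finset.min'_le _ _ h, Finset.le_max' _ _ h⟩, fun ⟨h1, h2⟩ => ?_⟩
  have hm := Finset.min'_mem _ hne
  have hM := Finset.max'_mem _ hne
  set m := (compJ J x).min' hne
  set M := (compJ J x).max' hne
  simp only [compJ, Finset.mem_filter] at hm hM
  have hb := reach_between J hm.1 ((stepJ_symm J hm.2).trans hM.2)
  have hr : Relation.ReflTransGen (stepJ J) m z := by
    apply reach_of_Icc' J h1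
    intro u hu
    rw [Finset.mem_Icc] at hu
    exact hb u (by omega)
  exact Finset.mem_filter.2 ⟨hb z (by omega), hm.2.trans hr⟩

lemma inner_one (b : ℕ) :
    ∑ a ∈ Finset.Icc 1 (b + 1), wB (a, b + 1) = 2 * b + 1 := by
  have h : Finset.Icc 1 (b + 1) = insert 1 (Finset.Icc 2 (b + 1)) := by
    ext z; simp; omega
  rw [h, Finset.sum_insert (by simp)]
  have : ∑ a ∈ Finset.Icc 2 (b + 1), wB (a, b + 1) = ∑ a ∈ Finset.Icc 2 (b + 1), 1 := by
    apply Finset.sum_congr rfl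
    intro a ha
    rw [Finset.mem_Icc] at ha
    have : a ≠ 1 := by omega
    simp [wB, this]
  rw [this]
  simp [wB]
  omega

lemma sum_one (M : ℕ) :
    ∑ b ∈ Finset.Icc 1 M, ∑ a ∈ Finset.Icc 1 b, wB (a, b) = M ^ 2 := by
  induction M with
  | zero => simp
  | succ M ih => rw [Finset.sum_Icc_succ_top (by omega), ih, inner_one]; ring

lemma sum_two (m k : ℕ) (hm : 2 ≤ m) :
    ∑ b ∈ Finset.Icc m (m + k), ∑ a ∈ Finset.Icc m b, wB (a, b) = (k + 2).choose 2 := by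
  have hin : ∀ b, ∑ a ∈ Finset.Icc m b, wB (a, b) = b + 1 - m := by
    intro b
    have : ∑ a ∈ Finset.Icc m b, wB (a, b) = ∑ a ∈ Finset.Icc m b, 1 := by
      apply Finset.sum_congr rfl
      intro a ha
      rw [Finset.mem_Icc] at ha
      have : a ≠ 1 := by omega
      simp [wB, this]
    rw [this]; simp
  simp only [hin]
  induction k with
  | zero => simp
  | succ k ih =>
    rw [← add_assoc, Finset.sum_Icc_succ_top (by omega), ih, Nat.choose_succ_succ' (k + 2) 1]
    simp
    omega

lemma sum_block (m M : ℕ) (hm : 1 ≤ m) (h : m ≤ M) :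
    (if 1 ∈ Finset.Icc m M ∧ 2 ∈ Finset.Icc m M then (Finset.Icc m M).card ^ 2
      else ((Finset.Icc m M).card + 1).choose 2) =
    ∑ p ∈ (Finset.Icc m M ×ˢ Finset.Icc m M).filter (fun p => p.1 ≤ p.2), wB p := by
  have hR : ∑ p ∈ (Finset.Icc m M ×ˢ Finset.Icc m M).filter (fun p => p.1 ≤ p.2), wB p =
      ∑ b ∈ Finset.Icc m M, ∑ a ∈ Finset.Icc m b, wB (a, b) := by
    rw [Finset.sum_filter, Finset.sum_product_right]
    apply Finset.sum_congr rfl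
    intro b hb
    rw [← Finset.sum_filter]
    apply Finset.sum_congr _ (fun _ _ => rfl)
    ext a
    simp at hb ⊢
    omega
  rw [hR]
  by_cases h1 : m = 1
  · subst h1
    rw [sum_one]
    by_cases h2 : M = 1
    · subst h2; simp
    · rw [if_pos (by simp; omega)]; simp
  · rw [if_neg (by simp; omega)]
    obtain ⟨k, rfl⟩ := Nat.exists_eq_add_of_le h
    rw [sum_two m k (by omega), Nat.card_Icc]
    congr 1
    omega

lemma degB_eq (l : ℕ) (J : Finset ℕ) (hJ : J ⊆ Finset.Icc 1 l) :
    degB J = ∑ p ∈ (Finset.Icc 1 l ×ˢ Finset.Icc 1 l).filter (fun p => p.1 ≤ p.2),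
      if Finset.Icc p.1 p.2 ⊆ J then wB p else 0 := by
  rw [← Finset.sum_filter]
  have hmap : ∀ p ∈ ((Finset.Icc 1 l ×ˢ Finset.Icc 1 l).filter (fun p => p.1 ≤ p.2)).filter
      (fun p => Finset.Icc p.1 p.2 ⊆ J), compJ J p.1 ∈ componentsOf adjA J := by
    intro p hp
    simp only [Finset.mem_filter] at hp
    exact Finset.mem_image_of_mem (compJ J)
      (hp.2 (Finset.left_mem_Icc.2 hp.1.2))
  rw [← Finset.sum_fiberwise_of_maps_to hmap]
  unfold degB
  apply Finset.sum_congr rfl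
  intro B hB
  obtain ⟨x, hx, rfl⟩ : ∃ x ∈ J, compJ J x = B := Finset.mem_image.1 hB
  obtain ⟨m, M, hmM, hI⟩ := compJ_interval J hx
  have hsub : Finset.Icc m M ⊆ J := hI ▸ Finset.filter_subset _ _
  have hm1 : 1 ≤ m := (Finset.mem_Icc.1 (hJ (hsub (Finset.left_mem_Icc.2 hmM)))).1
  have hreach : ∀ a ∈ Finset.Icc m M, compJ J a = Finset.Icc m M := by
    intro a ha
    rw [← hI] at ha ⊢
    exact (compJ_eq J (Finset.mem_filter.1 ha).2).symm
  rw [hI, sum_block m M hm1 hmM]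
  apply Finset.sum_congr _ (fun _ _ => rfl)
  ext ⟨a, b⟩
  simp only [Finset.mem_filter, Finset.mem_product]
  constructor
  · rintro ⟨⟨ha, hb⟩, hab⟩
    refine ⟨⟨⟨⟨hJ (hsub ha), hJ (hsub hb)⟩, hab⟩, fun z hz => hsub ?_⟩, hreach a ha⟩
    rw [Finset.mem_Icc] at *
    omega
  · rintro ⟨⟨⟨_, hab⟩, hs⟩, hc⟩
    refine ⟨⟨?_, ?_⟩, hab⟩
    · rw [← hc]
      exact Finset.mem_filter.2 ⟨hs (Finset.left_mem_Icc.2 hab), .refl⟩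
    · rw [← hc]
      exact Finset.mem_filter.2 ⟨hs (Finset.right_mem_Icc.2 hab), reach_of_Icc' J hab hs⟩

lemma alt_sum (I K : Finset ℕ) (hK : K ⊆ I) :
    ∑ J ∈ I.powerset, (if K ⊆ J then (-1 : ℤ) ^ J.card else 0) =
      if K = I then (-1) ^ I.card else 0 := by
  split_ifs with h
  · subst h
    rw [Finset.sum_eq_single K]
    · simp
    · intro J hJ hne
      rw [if_neg]
      intro hKJ
      exact hne (Finset.Subset.antisymm (Finset.mem_powerset.1 hJ) hKJ)
    · simp
  · obtain ⟨x, hxI, hxK⟩ : ∃ x ∈ I, x ∉ K := by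
      by_contra hc
      push Not at hc
      exact h (Finset.Subset.antisymm hK hc)
    rw [← Finset.insert_erase hxI, Finset.sum_powerset_insert (by simp), ← Finset.sum_add_distrib]
    apply Finset.sum_eq_zero
    intro J hJ
    have hxJ : x ∉ J := fun hxJ => by simpa using Finset.mem_powerset.1 hJ hxJ
    simp only [Finset.subset_insert_iff_of_notMem hxK, Finset.card_insert_of_notMem hxJ]
    split_ifs <;> ring

lemma alt_degB (l : ℕ) (hl : 2 ≤ l) :
    ∑ J ∈ (Finset.Icc 1 l).powerset, (-1 : ℤ) ^ J.card * (degB J : ℤ) = (-1) ^ l * l := by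
  have h1 : ∑ J ∈ (Finset.Icc 1 l).powerset, (-1 : ℤ) ^ J.card * (degB J : ℤ) =
      ∑ J ∈ (Finset.Icc 1 l).powerset,
        ∑ p ∈ (Finset.Icc 1 l ×ˢ Finset.Icc 1 l).filter (fun p => p.1 ≤ p.2),
          (wB p : ℤ) * (if Finset.Icc p.1 p.2 ⊆ J then (-1 : ℤ) ^ J.card else 0) := by
    apply Finset.sum_congr rfl
    intro J hJ
    rw [degB_eq l J (Finset.mem_powerset.1 hJ), Nat.cast_sum, Finset.mul_sum]
    apply Finset.sum_congr rfl
    intro p _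
    split_ifs <;> simp [mul_comm]
  rw [h1, Finset.sum_comm, Finset.sum_eq_single (1, l)]
  · rw [← Finset.mul_sum, alt_sum _ _ (Finset.Subset.refl _)]
    simp [wB, mul_comm]
  · rintro ⟨a, b⟩ hp hne
    simp only [Finset.mem_filter, Finset.mem_product, Finset.mem_Icc] at hp
    rw [← Finset.mul_sum, alt_sum, if_neg, mul_zero]
    · intro he
      have e1 : 1 ∈ Finset.Icc a b := by rw [he]; simp; omega
      have e2 : l ∈ Finset.Icc a b := by rw [he]; simp; omega
      rw [Finset.mem_Icc] at e1 e2
      apply hne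
      rw [Prod.mk.injEq]
      omega
    · intro z hz
      rw [Finset.mem_Icc] at *
      omega
  · intro h
    exfalso
    apply h
    simp
    omega

lemma NB_eval (l : ℕ) (hl : 2 ≤ l) : (NB l).eval 1 = 0 := by
  have h := alt_sum (Finset.Icc 1 l) ∅ (by simp)
  rw [if_neg] at h
  · simpa [NB, Polynomial.eval_finsetSum] using h
  · intro he
    have : 1 ∈ (∅ : Finset ℕ) := by rw [he]; simp; omega
    simp at this

lemma NB_deriv (l : ℕ) (hl : 2 ≤ l) :
    (Polynomial.derivative (NB l)).eval 1 = (-1) ^ l * l := by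
  rw [← alt_degB l hl, NB, Polynomial.derivative_sum, Polynomial.eval_finsetSum]
  apply Finset.sum_congr rfl
  intro J _
  have : (-1 : Polynomial ℤ) ^ J.card = Polynomial.C ((-1) ^ J.card) := by simp
  rw [this, Polynomial.derivative_C_mul, Polynomial.derivative_X_pow]
  simp

/-- For every integer `l ≥ 2`, the skew-growth polynomial `N_{B_l}(t)` has `t = 1`
as a root of multiplicity exactly one. -/
theorem skew_growth_simple_root_typeB (l : ℕ) (hl : 2 ≤ l) :
    Polynomial.rootMultiplicity 1 (NB l) = 1 := by
  have hd := NB_deriv l hl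
  have hne : (Polynomial.derivative (NB l)).eval 1 ≠ 0 := by
    rw [hd]
    have : (l : ℤ) ≠ 0 := by omega
    positivity
  have h0 : NB l ≠ 0 := by
    intro h
    rw [h] at hne
    simp at hne
  have hpos := (Polynomial.rootMultiplicity_pos h0).2 (NB_eval l hl)
  have hlt := (Polynomial.one_lt_rootMultiplicity_iff_isRoot h0 (t := 1)).not.2 (fun h => hne h.2)
  omega
end

section
/- For all positive integers l, j with j ≤ l, the following recurrence holds: C_{A_{l+1}, j+1} − C_{A_l, j} = (j + 1) · binomial(l + 1, j + 1), where C_{A_l, j} = Σ_{J ⊆ {1,...,l}, #J = j} deg_A(J). -/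
open scoped Classical

/-- `C_{A_l, j} = Σ_{J ⊆ {1,…,l}, #J = j} deg_A(J)`. -/
noncomputable def CA (l j : ℕ) : ℕ :=
  ∑ J ∈ (Finset.Icc 1 l).powerset.filter (fun J => J.card = j), degA J

theorem reach_symm {R : ℕ → ℕ → Prop} (hR : ∀ a b, R a b → R b a) {x y : ℕ}
    (h : Relation.ReflTransGen R x y) : Relation.ReflTransGen R y x := by
  induction h with
  | refl => exact .refl
  | tail _ h2 ih => exact Relation.ReflTransGen.head (hR _ _ h2) ih

theorem reach_iff (J : Finset ℕ) (x y : ℕ) (hx : x ∈ J) (hy : y ∈ J) :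
    Relation.ReflTransGen (fun a b => a ∈ J ∧ b ∈ J ∧ (adjA a b ∨ adjA b a)) x y ↔
      ∀ z, (x ≤ z ∧ z ≤ y ∨ y ≤ z ∧ z ≤ x) → z ∈ J := by
  constructor
  · intro h
    clear hy
    induction h with
    | refl =>
      intro z hz
      have : z = x := by omega
      rw [this]; exact hx
    | tail h1 h2 ih =>
      rename_i b c
      obtain ⟨hb, hc, h⟩ := h2
      simp only [adjA] at h
      intro z hz
      by_cases hzc : z = c
      · rw [hzc]; exact hc
      · apply ih; omega
  · have up : ∀ n x, (∀ z, x ≤ z → z ≤ x + n → z ∈ J) →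
        Relation.ReflTransGen (fun a b => a ∈ J ∧ b ∈ J ∧ (adjA a b ∨ adjA b a)) x (x + n) := by
      intro n
      induction n with
      | zero => intro x _; exact Relation.ReflTransGen.refl
      | succ n ih =>
        intro x h
        refine (ih x fun z h1 h2 => h z h1 (by omega)).tail ⟨h _ (by omega) (by omega),
          h _ (by omega) (by omega), Or.inl ?_⟩
        simp only [adjA]; omega
    intro h
    rcases le_total x y with hxy | hxy
    · obtain ⟨n, rfl⟩ := Nat.exists_eq_add_of_le hxy
      exact up n x fun z h1 h2 => h z (Or.inl ⟨h1, h2⟩)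
    · obtain ⟨n, rfl⟩ := Nat.exists_eq_add_of_le hxy
      have := up n y fun z h1 h2 => h z (Or.inr ⟨h1, h2⟩)
      refine reach_symm ?_ this
      rintro a b ⟨h1, h2, h3⟩
      exact ⟨h2, h1, h3.symm⟩

theorem card_pairs (B : Finset ℕ) :
    ((B ×ˢ B).filter fun p => p.1 ≤ p.2).card = (B.card + 1).choose 2 := by
  induction B using Finset.induction_on_max with
  | empty => simp
  | insert a s hs ih =>
    have ha : a ∉ s := fun h => lt_irrefl _ (hs a h)
    have : ((insert a s ×ˢ insert a s).filter fun p => p.1 ≤ p.2) =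
        ((s ×ˢ s).filter fun p => p.1 ≤ p.2) ∪ (insert a s).image (fun x => (x, a)) := by
      ext ⟨x, y⟩
      simp only [Finset.mem_filter, Finset.mem_product, Finset.mem_insert, Finset.mem_union,
        Finset.mem_image, Prod.mk.injEq]
      constructor
      · rintro ⟨⟨h1, h2⟩, h3⟩
        rcases h2 with rfl | h2
        · exact Or.inr ⟨x, h1, rfl, rfl⟩
        · rcases h1 with rfl | h1
          · have := hs y h2; omega
          · exact Or.inl ⟨⟨h1, h2⟩, h3⟩
      · rintro (⟨⟨h1, h2⟩, h3⟩ | ⟨z, hz, rfl, rfl⟩)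
        · exact ⟨⟨Or.inr h1, Or.inr h2⟩, h3⟩
        · refine ⟨⟨hz, Or.inl rfl⟩, ?_⟩
          rcases hz with rfl | hz
          · exact le_rfl
          · exact (hs _ hz).le
    rw [this, Finset.card_union_of_disjoint, ih, Finset.card_image_of_injective,
      Finset.card_insert_of_notMem ha, Nat.choose_succ_succ' (s.card + 1) 1]
    · simp; omega
    · intro x y h; exact (Prod.mk.inj h).1
    · rw [Finset.disjoint_left]
      rintro ⟨x, y⟩ h1 h2
      simp only [Finset.mem_filter, Finset.mem_product, Finset.mem_image, Prod.mk.injEq] at h1 h2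
      obtain ⟨z, _, _, rfl⟩ := h2
      exact ha h1.1.2

theorem degA_eq (J : Finset ℕ) :
    degA J = ((J ×ˢ J).filter fun p => p.1 ≤ p.2 ∧ Finset.Icc p.1 p.2 ⊆ J).card := by
  set R := fun a b => a ∈ J ∧ b ∈ J ∧ (adjA a b ∨ adjA b a) with hR
  have hsym : ∀ x y, Relation.ReflTransGen R x y → Relation.ReflTransGen R y x := by
    intro x y h
    refine reach_symm ?_ h
    rintro a b ⟨h1, h2, h3⟩
    exact ⟨h2, h1, h3.symm⟩
  have hreach : ∀ x y, x ∈ J → y ∈ J → x ≤ y →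
      (Relation.ReflTransGen R x y ↔ Finset.Icc x y ⊆ J) := by
    intro x y hx hy hxy
    rw [hR, reach_iff J x y hx hy]
    constructor
    · intro h z hz
      rw [Finset.mem_Icc] at hz
      exact h z (Or.inl hz)
    · intro h z hz
      exact h (Finset.mem_Icc.2 (by omega))
  rw [Finset.card_eq_sum_card_fiberwise
    (f := fun p => J.filter fun y => Relation.ReflTransGen R p.1 y) (t := componentsOf adjA J)]
  · unfold degA
    refine Finset.sum_congr rfl fun B hB => ?_
    rw [← card_pairs]
    congr 1
    obtain ⟨x, hx, rfl⟩ := Finset.mem_image.1 hB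
    ext ⟨a, b⟩
    simp only [Finset.mem_filter, Finset.mem_product]
    constructor
    · rintro ⟨⟨⟨ha, hxa⟩, hb, hxb⟩, hab⟩
      have hab' := (hsym _ _ hxa).trans hxb
      refine ⟨⟨⟨ha, hb⟩, hab, (hreach a b ha hb hab).1 hab'⟩, ?_⟩
      ext z
      simp only [Finset.mem_filter]
      exact ⟨fun h => ⟨h.1, Relation.ReflTransGen.trans hxa h.2⟩,
        fun h => ⟨h.1, Relation.ReflTransGen.trans (hsym _ _ hxa) h.2⟩⟩
    · rintro ⟨⟨⟨ha, hb⟩, hab, hI⟩, hE⟩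
      have hab' := (hreach a b ha hb hab).2 hI
      have key : ∀ z, z ∈ J → Relation.ReflTransGen R a z → Relation.ReflTransGen R x z := by
        intro z hz h
        have : z ∈ J.filter fun y => Relation.ReflTransGen R a y :=
          Finset.mem_filter.2 ⟨hz, h⟩
        rw [hE] at this
        exact (Finset.mem_filter.1 this).2
      exact ⟨⟨⟨ha, key a ha .refl⟩, hb, key b hb hab'⟩, hab⟩
  · intro p hp
    have hp := (Finset.mem_filter.1 hp).1
    exact Finset.mem_image_of_mem _ (Finset.mem_product.1 hp).1

theorem degA_eq_sum (l : ℕ) (J : Finset ℕ) (hJ : J ⊆ Finset.Icc 1 l) :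
    degA J = ∑ x ∈ Finset.Icc 1 l, ∑ y ∈ Finset.Icc x l,
      if Finset.Icc x y ⊆ J then 1 else 0 := by
  rw [degA_eq, Finset.sum_sigma', ← Finset.sum_filter, ← Finset.card_eq_sum_ones]
  refine Finset.card_bij' (fun p _ => ⟨p.1, p.2⟩) (fun p _ => (p.1, p.2)) ?_ ?_ ?_ ?_
  · rintro ⟨x, y⟩ h
    simp only [Finset.mem_filter, Finset.mem_product, Finset.mem_sigma] at h ⊢
    have h1 := Finset.mem_Icc.1 (hJ h.1.1)
    have h2 := Finset.mem_Icc.1 (hJ h.1.2)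
    simp only [Finset.mem_Icc]
    exact ⟨⟨h1, h.2.1, h2.2⟩, h.2.2⟩
  · rintro ⟨x, y⟩ h
    simp only [Finset.mem_filter, Finset.mem_product, Finset.mem_sigma] at h ⊢
    have h1 := Finset.mem_Icc.1 h.1.2
    exact ⟨⟨h.2 (Finset.mem_Icc.2 ⟨le_rfl, h1.1⟩), h.2 (Finset.mem_Icc.2 ⟨h1.1, le_rfl⟩)⟩,
      h1.1, h.2⟩
  · intros; rfl
  · intros; rfl

theorem card_super (T S : Finset ℕ) (hS : S ⊆ T) (j : ℕ) :
    ((T.powerset.filter fun J => J.card = j).filter fun J => S ⊆ J).card =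
      if S.card ≤ j then (T.card - S.card).choose (j - S.card) else 0 := by
  split_ifs with h
  · rw [← Finset.card_sdiff_of_subset hS, ← Finset.card_powersetCard]
    refine Finset.card_bij' (fun J _ => J \ S) (fun J _ => J ∪ S) ?_ ?_ ?_ ?_
    · intro J hJ
      simp only [Finset.mem_filter, Finset.mem_powerset, Finset.mem_powersetCard] at hJ ⊢
      refine ⟨Finset.sdiff_subset_sdiff hJ.1.1 subset_rfl, ?_⟩
      rw [Finset.card_sdiff_of_subset hJ.2, hJ.1.2]
    · intro J hJ
      simp only [Finset.mem_filter, Finset.mem_powerset, Finset.mem_powersetCard] at hJ ⊢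
      have hd : Disjoint J S := Finset.disjoint_of_subset_left hJ.1 Finset.sdiff_disjoint
      refine ⟨⟨Finset.union_subset (hJ.1.trans Finset.sdiff_subset) hS, ?_⟩,
        Finset.subset_union_right⟩
      rw [Finset.card_union_of_disjoint hd, hJ.2]; omega
    · intro J hJ
      exact Finset.sdiff_union_of_subset (Finset.mem_filter.1 hJ).2
    · intro J hJ
      have hd : Disjoint J S := Finset.disjoint_of_subset_left (Finset.mem_powersetCard.1 hJ).1
        Finset.sdiff_disjoint
      exact Finset.union_sdiff_cancel_right hd
  · rw [Finset.card_eq_zero, Finset.filter_eq_empty_iff]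
    intro J hJ hSJ
    have := Finset.card_le_card hSJ
    rw [(Finset.mem_filter.1 hJ).2] at this
    exact h this

theorem CA_eq (l j : ℕ) :
    CA l j = ∑ x ∈ Finset.Icc 1 l, ∑ y ∈ Finset.Icc x l,
      if y + 1 - x ≤ j then (l - (y + 1 - x)).choose (j - (y + 1 - x)) else 0 := by
  unfold CA
  rw [Finset.sum_congr rfl fun J hJ =>
    degA_eq_sum l J (Finset.mem_powerset.1 (Finset.mem_filter.1 hJ).1), Finset.sum_comm]
  refine Finset.sum_congr rfl fun x hx => ?_
  rw [Finset.sum_comm]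
  refine Finset.sum_congr rfl fun y hy => ?_
  rw [← Finset.sum_filter, ← Finset.card_eq_sum_ones, card_super]
  · simp
  · rw [Finset.mem_Icc] at hx hy
    exact Finset.Icc_subset_Icc hx.1 hy.2

theorem CA_rec_nat (l j : ℕ) :
    CA (l + 1) (j + 1) = (l + 1) * l.choose j + CA l j := by
  rw [CA_eq, CA_eq]
  have h1 : ∀ x ∈ Finset.Icc 1 (l + 1), (∑ y ∈ Finset.Icc x (l + 1),
      if y + 1 - x ≤ j + 1 then (l + 1 - (y + 1 - x)).choose (j + 1 - (y + 1 - x)) else 0) =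
      l.choose j + ∑ y ∈ Finset.Icc x l,
        if y + 1 - x ≤ j then (l - (y + 1 - x)).choose (j - (y + 1 - x)) else 0 := by
    intro x hx
    rw [Finset.mem_Icc] at hx
    rw [← Finset.add_sum_Ioc_eq_sum_Icc hx.2]
    congr 1
    · simp
    · refine Finset.sum_bij' (fun y _ => y - 1) (fun y _ => y + 1) ?_ ?_ ?_ ?_ ?_
      · intro y hy; simp only [Finset.mem_Ioc, Finset.mem_Icc] at *; omega
      · intro y hy; simp only [Finset.mem_Ioc, Finset.mem_Icc] at *; omega
      · intro y hy; simp only [Finset.mem_Ioc] at *; omega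
      · intro y hy; simp
      · intro y hy
        simp only [Finset.mem_Ioc] at hy
        obtain ⟨m, rfl⟩ : ∃ m, y = x + 1 + m := ⟨y - x - 1, by omega⟩
        have e1 : x + 1 + m + 1 - x = m + 2 := by omega
        have e2 : x + 1 + m - 1 + 1 - x = m + 1 := by omega
        simp only [e1, e2]
        have e3 : l + 1 - (m + 2) = l - (m + 1) := by omega
        have e4 : j + 1 - (m + 2) = j - (m + 1) := by omega
        rw [e3, e4]
        by_cases hm : m + 1 ≤ j
        · rw [if_pos hm, if_pos (by omega)]
        · rw [if_neg hm, if_neg (by omega)]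
  rw [Finset.sum_congr rfl h1, Finset.sum_add_distrib, Finset.sum_const,
    Finset.sum_Icc_succ_top (by omega)]
  simp

/-- For all positive integers `l, j` with `j ≤ l`,
`C_{A_{l+1}, j+1} − C_{A_l, j} = (j + 1) · binom(l + 1, j + 1)`. -/
theorem CA_recurrence (l j : ℕ) (hj : 1 ≤ j) (hjl : j ≤ l) :
    (CA (l + 1) (j + 1) : ℤ) - (CA l j : ℤ)
      = ((j : ℤ) + 1) * ((l + 1).choose (j + 1) : ℤ) := by
  have h := CA_rec_nat l j
  have h2 := Nat.add_one_mul_choose_eq l j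
  rw [h2] at h
  rw [h]
  push_cast
  ring
end
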